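/- arXiv:1602.06569 — 7 statements merged into one kernel-verified Lean document; each statement's English description precedes it below -/
import Mathlib

section
/- Let R be a commutative ring, P = R[x_1,...,x_n] the polynomial ring in n variables, and f_1,...,f_c ∈ P with c ≤ n. Let S = P/(f_1,...,f_c), and let J be the c × c matrix whose (i,j)-entry is the image in S of the formal partial derivative ∂f_i/∂x_j for 1 ≤ i, j ≤ c. If det(J) is a unit in S, then S is formally smooth as an R-algebra. -/
/-- If `S = R[x_1,…,x_n]/(f_1,…,f_c)` with `c ≤ n` and the `c × c`
Jacobian matrix `J` with `(i,j)`-entry the image in `S` of `∂f_i/∂x_j` has invertible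
determinant in `S`, then `S` is formally smooth as an `R`-algebra. -/
theorem jacobian_det_isUnit_formallySmooth
    {R : Type} [CommRing R] {n c : ℕ} (hcn : c ≤ n)
    (f : Fin c → MvPolynomial (Fin n) R)
    (hJ : IsUnit (Matrix.det (Matrix.of fun i j : Fin c =>
      Ideal.Quotient.mk (Ideal.span (Set.range f))
        (MvPolynomial.pderiv (Fin.castLE hcn j) (f i))))) :
    Algebra.FormallySmooth R (MvPolynomial (Fin n) R ⧸ Ideal.span (Set.range f)) := by
  let P : Algebra.PreSubmersivePresentation R
      (MvPolynomial (Fin n) R ⧸ Ideal.span (Set.range f)) (Fin n) (Fin c) :=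
    { Algebra.Presentation.naive (v := f) with
      map := Fin.castLE hcn
      map_inj := Fin.castLE_injective hcn }
  have hP : IsUnit P.jacobian := by
    rw [P.jacobian_eq_jacobiMatrix_det]
    change IsUnit (Ideal.Quotient.mk (Ideal.span (Set.range f)) P.jacobiMatrix.det)
    rw [RingHom.map_det, ← Matrix.det_transpose]
    convert hJ using 2
    ext i j
    exact congrArg (Ideal.Quotient.mk (Ideal.span (Set.range f))) (P.jacobiMatrix_apply j i)
  have : Algebra.IsStandardSmooth R (MvPolynomial (Fin n) R ⧸ Ideal.span (Set.range f)) :=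
    Algebra.SubmersivePresentation.isStandardSmooth
      { toPreSubmersivePresentation := P, jacobian_isUnit := hP }
  exact Algebra.Smooth.formallySmooth
end

section
/- Let R be a commutative ring, P = R[x_1,...,x_n], and f_1,...,f_c ∈ P with c ≤ n. Let S = P/(f_1,...,f_c), let J be the c × c matrix with (i,j)-entry the image in S of ∂f_i/∂x_j for 1 ≤ i, j ≤ c, and let Δ = det(J) ∈ S. Then the principal localization S_Δ = S[1/Δ] is formally smooth as an R-algebra. -/
/-- If `S = R[x_1,…,x_n]/(f_1,…,f_c)` with `c ≤ n`, `J` is the `c × c`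
Jacobian matrix with `(i,j)`-entry the image in `S` of `∂f_i/∂x_j`, and `Δ = det J ∈ S`,
then the principal localization `S_Δ = S[1/Δ]` is formally smooth as an `R`-algebra. -/
theorem localization_away_jacobian_det_formallySmooth
    {R : Type} [CommRing R] {n c : ℕ} (hcn : c ≤ n)
    (f : Fin c → MvPolynomial (Fin n) R)
    (Δ : MvPolynomial (Fin n) R ⧸ Ideal.span (Set.range f))
    (hΔ : Δ = Matrix.det (Matrix.of fun i j : Fin c =>
      Ideal.Quotient.mk (Ideal.span (Set.range f))
        (MvPolynomial.pderiv (Fin.castLE hcn j) (f i)))) :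
    Algebra.FormallySmooth R (Localization.Away Δ) := by
  let P : Algebra.PreSubmersivePresentation R
      (MvPolynomial (Fin n) R ⧸ Ideal.span (Set.range f)) (Fin n) (Fin c) :=
    .naive (Fin.castLE hcn) (Fin.castLE_injective hcn)
      (Function.surjInv Ideal.Quotient.mk_surjective)
      (Function.surjInv_eq Ideal.Quotient.mk_surjective)
  have hP : P.jacobian = Δ := by
    rw [P.jacobian_eq_jacobiMatrix_det, RingHom.map_det, hΔ, ← Matrix.det_transpose]
    congr 1
    ext i j
    exact congrArg (Ideal.Quotient.mk (Ideal.span (Set.range f))) (P.jacobiMatrix_apply j i)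
  have : IsLocalization.Away P.jacobian (Localization.Away Δ) := by
    rw [hP]; infer_instance
  let Q := Algebra.PreSubmersivePresentation.localizationAway (Localization.Away Δ) P.jacobian
  have hQ : IsUnit (Q.comp P).jacobian := by
    rw [Algebra.PreSubmersivePresentation.comp_jacobian_eq_jacobian_smul_jacobian,
      Algebra.PreSubmersivePresentation.localizationAway_jacobian, Algebra.smul_def]
    exact (IsLocalization.Away.algebraMap_isUnit _).mul (IsLocalization.Away.algebraMap_isUnit _)
  have := Algebra.SubmersivePresentation.isStandardSmooth ⟨Q.comp P, hQ⟩
  infer_instance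
end

section
/- Let R be a commutative ring and T a standard smooth R-algebra. For any g ∈ T, the principal localization T_g = T[1/g] is again a standard smooth R-algebra. -/
/-- An `R`-algebra `S` is *standard smooth* if `S ≅ R[x_1,…,x_n]/(f_1,…,f_c)` with
`c ≤ n` such that the `c × c` matrix with `(i,j)`-entry the image of `∂f_i/∂x_j`
(`1 ≤ i, j ≤ c`) has determinant invertible in `S` (equivalently, in the quotient). -/
def StandardSmoothAlgebra (R S : Type) [CommRing R] [CommRing S] [Algebra R S] : Prop :=
  ∃ (n c : ℕ) (hcn : c ≤ n) (f : Fin c → MvPolynomial (Fin n) R)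
    (_ : (MvPolynomial (Fin n) R ⧸ Ideal.span (Set.range f)) ≃ₐ[R] S),
    IsUnit (Matrix.det (Matrix.of fun i j : Fin c =>
      Ideal.Quotient.mk (Ideal.span (Set.range f))
        (MvPolynomial.pderiv (Fin.castLE hcn j) (f i))))

namespace Algebra

theorem PreSubmersivePresentation.jacobian_eq_det_pderiv {R S ι σ : Type*} [CommRing R]
    [CommRing S] [Algebra R S] [Fintype σ] [DecidableEq σ]
    (P : PreSubmersivePresentation R S ι σ) :
    P.jacobian = Matrix.det (Matrix.of fun i j : σ =>
      algebraMap P.Ring S (MvPolynomial.pderiv (P.map j) (P.relation i))) := by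
  rw [P.jacobian_eq_jacobiMatrix_det, RingHom.map_det, ← Matrix.det_transpose]
  congr 1
  ext i j
  simp [P.jacobiMatrix_apply]

theorem SubmersivePresentation.exists_fin_map_eq_castLE {R S ι σ : Type*} [CommRing R]
    [CommRing S] [Algebra R S] [Finite ι] [Finite σ] (P : SubmersivePresentation R S ι σ) :
    ∃ (n c : ℕ) (hcn : c ≤ n) (Q : SubmersivePresentation R S (Fin n) (Fin c)),
      Q.map = Fin.castLE hcn := by
  let f := (Finite.equivFin σ).symm
  let e := Finite.equivFin ι
  have hcn := P.card_relations_le_card_vars_of_isFinite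
  obtain ⟨τ, hτ⟩ := Equiv.Perm.exists_extending_pair (e ∘ P.map ∘ f) (Fin.castLE hcn)
    (e.injective.comp (P.map_inj.comp f.injective)) (Fin.castLE_injective hcn)
  exact ⟨_, _, hcn, P.reindex (e.trans τ).symm f, funext hτ⟩

end Algebra

theorem StandardSmoothAlgebra.isStandardSmooth {R S : Type} [CommRing R] [CommRing S]
    [Algebra R S] (h : StandardSmoothAlgebra R S) : Algebra.IsStandardSmooth R S := by
  obtain ⟨n, c, hcn, f, e, hf⟩ := h
  let P : Algebra.SubmersivePresentation R (MvPolynomial (Fin n) R ⧸ Ideal.span (Set.range f))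
      (Fin n) (Fin c) :=
    { toPreSubmersivePresentation :=
        .naive (Fin.castLE hcn) (Fin.castLE_injective hcn)
      jacobian_isUnit := by
        rw [Algebra.PreSubmersivePresentation.jacobian_eq_det_pderiv]
        exact hf }
  exact (P.ofAlgEquiv e).isStandardSmooth

theorem StandardSmoothAlgebra.of_isStandardSmooth {R S : Type} [CommRing R] [CommRing S]
    [Algebra R S] [Algebra.IsStandardSmooth R S] : StandardSmoothAlgebra R S := by
  obtain ⟨_, _, _, _, ⟨P⟩⟩ := ‹Algebra.IsStandardSmooth R S›
  obtain ⟨n, c, hcn, Q, hQ⟩ := P.exists_fin_map_eq_castLE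
  let e : (MvPolynomial (Fin n) R ⧸ Ideal.span (Set.range Q.relation)) ≃ₐ[R] S :=
    (Ideal.quotientEquivAlgOfEq R Q.span_range_relation_eq_ker).trans
      (Q.quotientEquiv.restrictScalars R)
  refine ⟨n, c, hcn, Q.relation, e, (MulEquiv.isUnit_map e).mp ?_⟩
  have h := Q.jacobian_isUnit
  rw [Algebra.PreSubmersivePresentation.jacobian_eq_det_pderiv, hQ] at h
  rw [AlgEquiv.map_det]
  exact h

/-- A principal localization `T_g = T[1/g]` of a standard smooth
`R`-algebra `T` is again a standard smooth `R`-algebra. -/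
theorem standardSmooth_localization_away
    {R T : Type} [CommRing R] [CommRing T] [Algebra R T]
    (hT : StandardSmoothAlgebra R T) (g : T) :
    StandardSmoothAlgebra R (Localization.Away g) := by
  have := hT.isStandardSmooth
  have := Algebra.IsStandardSmooth.localization_away (S := Localization.Away g) g
  have := Algebra.IsStandardSmooth.trans R T (Localization.Away g)
  exact .of_isStandardSmooth
end

section
/- Let R be a commutative ring, S an R-algebra, and I an ideal of S such that S̄ = S/I is formally smooth as an R-algebra. Then the S̄-linear map I/I² → Ω_{S/R} ⊗_S S̄ induced by the universal derivation d_S is injective, its image is a direct summand of Ω_{S/R} ⊗_S S̄, and the quotient by this image is isomorphic to Ω_{S̄/R}; that is, the conormal sequence 0 → I/I² → Ω_{S/R} ⊗_S S̄ → Ω_{S̄/R} → 0 is split exact. -/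
open TensorProduct

namespace KaehlerDifferential

/-- If `B` is formally smooth over `R` and `A → B` is surjective with kernel `I`, then
`I/I² → B ⊗[A] Ω[A⁄R]` has an `A`-linear retraction. -/
theorem exists_retraction_kerCotangentToTensor {R A B : Type*} [CommRing R] [CommRing A]
    [CommRing B] [Algebra R A] [Algebra A B] [Algebra R B] [IsScalarTower R A B]
    [Algebra.FormallySmooth R B] (hf : Function.Surjective (algebraMap A B)) :
    ∃ l, l ∘ₗ kerCotangentToTensor R A B = LinearMap.id := by
  let f := (IsScalarTower.toAlgHom R A B).kerSquareLift
  have surj : Function.Surjective f := Ideal.Quotient.lift_surjective_of_surjective _ _ hf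
  have nil : IsNilpotent (RingHom.ker f.toRingHom) :=
    ⟨2, by rw [AlgHom.ker_kerSquareLift, Ideal.cotangentIdeal_square]; rfl⟩
  exact ⟨_, ((retractionKerCotangentToTensorEquivSection (R := R) hf).symm
    ⟨_, Algebra.FormallySmooth.comp_liftOfSurjective (AlgHom.id R B) f surj nil⟩).2⟩

theorem conormal_split_exact_of_ker_eq {R A B : Type*} [CommRing R] [CommRing A]
    [CommRing B] [Algebra R A] [Algebra A B] [Algebra R B] [IsScalarTower R A B]
    [Algebra.FormallySmooth R B] (hf : Function.Surjective (algebraMap A B))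
    {I : Ideal A} (hI : RingHom.ker (algebraMap A B) = I)
    (φ : I.Cotangent →ₗ[A] B ⊗[A] Ω[A⁄R])
    (hφ : ∀ x : I, φ (I.toCotangent x) = 1 ⊗ₜ[A] D R A x.1) :
    Function.Injective φ ∧
      (∃ l : B ⊗[A] Ω[A⁄R] →ₗ[A] I.Cotangent, l ∘ₗ φ = LinearMap.id) ∧
      LinearMap.range φ = (LinearMap.ker (mapBaseChange R A B)).restrictScalars A ∧
      Function.Surjective (mapBaseChange R A B) := by
  subst hI
  obtain rfl : φ = kerCotangentToTensor R A B := by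
    ext x
    obtain ⟨x, rfl⟩ := Ideal.toCotangent_surjective _ x
    exact hφ x
  obtain ⟨l, hl⟩ := exists_retraction_kerCotangentToTensor (R := R) hf
  exact ⟨Function.LeftInverse.injective (LinearMap.congr_fun hl), ⟨l, hl⟩,
    range_kerCotangentToTensor R A B hf, mapBaseChange_surjective R A B hf⟩

end KaehlerDifferential

/-- If `S̄ = S/I` is formally smooth over `R`, then the conormal
sequence `0 → I/I² → Ω_{S/R} ⊗_S S̄ → Ω_{S̄/R} → 0` is split exact: the map
`φ : I/I² → S̄ ⊗_S Ω_{S/R}` induced by the universal derivation (the class of `f ∈ I`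
goes to `d_S f ⊗ 1`) is injective, admits a linear retraction (so its image is a direct
summand), its range is exactly the kernel of the canonical map
`S̄ ⊗_S Ω_{S/R} → Ω_{S̄/R}`, and that canonical map is surjective (so the quotient of
`S̄ ⊗_S Ω_{S/R}` by the image of `I/I²` is isomorphic to `Ω_{S̄/R}`). -/
theorem conormal_sequence_split_exact_of_formallySmooth
    {R S : Type} [CommRing R] [CommRing S] [Algebra R S] (I : Ideal S)
    [Algebra.FormallySmooth R (S ⧸ I)]
    (φ : I.Cotangent →ₗ[S] (S ⧸ I) ⊗[S] Ω[S⁄R])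
    (hφ : ∀ x : I, φ (I.toCotangent x) = 1 ⊗ₜ[S] (KaehlerDifferential.D R S x.1)) :
    Function.Injective φ ∧
      (∃ l : (S ⧸ I) ⊗[S] Ω[S⁄R] →ₗ[S] I.Cotangent, l ∘ₗ φ = LinearMap.id) ∧
      LinearMap.range φ =
        (LinearMap.ker (KaehlerDifferential.mapBaseChange R S (S ⧸ I))).restrictScalars S ∧
      Function.Surjective (KaehlerDifferential.mapBaseChange R S (S ⧸ I)) := by
  have hI : RingHom.ker (algebraMap S (S ⧸ I)) = I := by
    rw [Ideal.Quotient.algebraMap_eq, Ideal.mk_ker]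
  exact KaehlerDifferential.conormal_split_exact_of_ker_eq (B := S ⧸ I)
    Ideal.Quotient.mk_surjective hI φ hφ
end

section
/- Let R be a commutative ring and S a finitely presented R-algebra. Then the set of prime ideals 𝔭 of S such that the induced map R_{𝔭'} → S_𝔭 is formally smooth (where 𝔭' is the contraction of 𝔭 to R) is an open subset of the prime spectrum Spec(S) in the Zariski topology. -/
/-- For a finitely presented `R`-algebra `S`, the set of primes `𝔭`
of `S` such that the induced map `R_{𝔭'} → S_𝔭` is formally smooth (`𝔭'` the
contraction of `𝔭` to `R`) is open in `Spec S` with the Zariski topology. -/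
theorem isOpen_formallySmooth_locus
    {R S : Type} [CommRing R] [CommRing S] [Algebra R S]
    (hfp : Algebra.FinitePresentation R S) :
    IsOpen {p : PrimeSpectrum S |
      letI : Algebra (Localization.AtPrime (p.asIdeal.comap (algebraMap R S)))
          (Localization.AtPrime p.asIdeal) :=
        (Localization.localRingHom (p.asIdeal.comap (algebraMap R S)) p.asIdeal
          (algebraMap R S) rfl).toAlgebra
      Algebra.FormallySmooth (Localization.AtPrime (p.asIdeal.comap (algebraMap R S)))
        (Localization.AtPrime p.asIdeal)} := by
  have := hfp
  convert Algebra.isOpen_smoothLocus (R := R) (A := S) using 1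
  ext p
  let : Algebra (Localization.AtPrime (p.asIdeal.comap (algebraMap R S)))
      (Localization.AtPrime p.asIdeal) :=
    (Localization.localRingHom (p.asIdeal.comap (algebraMap R S)) p.asIdeal
      (algebraMap R S) rfl).toAlgebra
  have : IsScalarTower R (Localization.AtPrime (p.asIdeal.comap (algebraMap R S)))
      (Localization.AtPrime p.asIdeal) := .of_algebraMap_eq fun r ↦ by
    rw [RingHom.algebraMap_toAlgebra, Localization.localRingHom_to_map,
      ← IsScalarTower.algebraMap_apply]
  have : Algebra.FormallyEtale R (Localization.AtPrime (p.asIdeal.comap (algebraMap R S))) :=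
    .of_isLocalization (p.asIdeal.comap (algebraMap R S)).primeCompl
  exact Algebra.FormallySmooth.iff_restrictScalars.symm
end

section
/- Let R be a commutative ring, P = R[x_1,...,x_n], f_1,...,f_c ∈ P, I_1 = (f_1,...,f_c), and S̄ = P/I_1. Let 𝔭̄ be a prime ideal of S̄ with preimage 𝔭̃ in P and contraction 𝔭' in R. Then the induced map R_{𝔭'} → S̄_{𝔭̄} is formally smooth if and only if there exist m ∈ ℕ with m ≤ min(c, n), an injective map ρ : {1,...,m} → {1,...,c}, and an injective map τ : {1,...,m} → {1,...,n} such that, setting I_0 = (f_{ρ(1)},...,f_{ρ(m)}) and Δ = det of the m × m matrix with (i,j)-entry ∂f_{ρ(i)}/∂x_{τ(j)}, one has Δ ∉ 𝔭̃ and the colon ideal (I_0 : I_1) = {g ∈ P : g·I_1 ⊆ I_0} is not contained in 𝔭̃. -/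
section

open TensorProduct KaehlerDifferential

/-- A matrix over a field with linearly independent rows has an invertible maximal minor. -/
lemma Matrix.exists_isUnit_det_submatrix_of_linearIndependent_row {K m n : Type*} [Field K]
    [Fintype m] [DecidableEq m] [Fintype n] (A : Matrix m n K) (hA : LinearIndependent K A.row) :
    ∃ τ : m ↪ n, IsUnit (A.submatrix id τ).det := by
  obtain ⟨κ, a, ha, hspan, hli⟩ := exists_linearIndependent' K A.col
  have : Finite κ := .of_injective a ha
  have := Fintype.ofFinite κ
  have hcard : Fintype.card m = Fintype.card κ := by
    rw [linearIndependent_iff_card_eq_finrank_span.mp hli, Set.finrank, hspan,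
      ← A.rank_eq_finrank_span_cols, hA.rank_matrix]
  let e : m ≃ κ := Fintype.equivOfCardEq hcard
  refine ⟨e.toEmbedding.trans ⟨a, ha⟩, ?_⟩
  rw [← Matrix.isUnit_iff_isUnit_det, ← Matrix.linearIndependent_cols_iff_isUnit]
  exact (linearIndependent_equiv e).mpr hli

/-- A linear map out of the span of a finite family `w` is injective iff some subfamily of `w` spans
and has an image with an invertible maximal minor. -/
lemma LinearMap.injective_iff_exists_isUnit_det {K V W ι : Type*} {c : ℕ} [Field K]
    [AddCommGroup V] [Module K V] [AddCommGroup W] [Module K W] [Fintype ι] (φ : W →ₗ[K] V)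
    (b : Module.Basis ι K V) (w : Fin c → W) (hw : Submodule.span K (Set.range w) = ⊤) :
    Function.Injective φ ↔
      ∃ (m : ℕ) (ρ : Fin m ↪ Fin c) (τ : Fin m ↪ ι),
        IsUnit (Matrix.det (Matrix.of fun i j => b.repr (φ (w (ρ i))) (τ j))) ∧
          Submodule.span K (Set.range (w ∘ ρ)) = ⊤ := by
  constructor
  · intro hinj
    obtain ⟨κ, a, ha, hsp, hli⟩ := exists_linearIndependent' K w
    have : Finite κ := .of_injective a ha
    let e := (Finite.equivFin κ).symm
    let ρ : Fin (Nat.card κ) ↪ Fin c := e.toEmbedding.trans ⟨a, ha⟩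
    have hli : LinearIndependent K (w ∘ ρ) := (linearIndependent_equiv e).mpr hli
    have hrange : Set.range (w ∘ ρ) = Set.range (w ∘ a) := e.surjective.range_comp (w ∘ a)
    have hrow : LinearIndependent K (Matrix.of fun i j => b.repr (φ (w (ρ i))) j).row :=
      (hli.map' φ (LinearMap.ker_eq_bot.mpr hinj)).map' b.equivFun.toLinearMap b.equivFun.ker
    obtain ⟨τ, hτ⟩ := Matrix.exists_isUnit_det_submatrix_of_linearIndependent_row _ hrow
    exact ⟨_, ρ, τ, hτ, by rw [hrange, hsp, hw]⟩
  · rintro ⟨m, ρ, τ, hunit, hsp⟩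
    have hrow := Matrix.linearIndependent_rows_iff_isUnit.mpr
      ((Matrix.isUnit_iff_isUnit_det _).mpr hunit)
    let π : V →ₗ[K] (Fin m → K) := LinearMap.funLeft K K τ ∘ₗ b.equivFun.toLinearMap
    have hli : LinearIndependent K ((π ∘ₗ φ) ∘ (w ∘ ρ)) := hrow
    have hdisj := Submodule.range_ker_disjoint hli
    rw [hsp, disjoint_iff, top_inf_eq, LinearMap.ker_eq_bot] at hdisj
    exact Function.Injective.of_comp (f := π) hdisj

/-- Nakayama's lemma, where the residue field of the local ring `A` is replaced by any field onto
which `A` surjects. -/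
lemma IsLocalRing.span_range_eq_top_of_tmul {A K M ι : Type*} [CommRing A] [IsLocalRing A]
    [Field K] [Algebra A K] (hK : Function.Surjective (algebraMap A K)) [AddCommGroup M]
    [Module A M] [Module.Finite A M] (v : ι → M)
    (hv : Submodule.span K (Set.range fun i => (1 : K) ⊗ₜ[A] v i) = ⊤) :
    Submodule.span A (Set.range v) = ⊤ := by
  set N := Submodule.span A (Set.range v) with hN
  have hker : maximalIdeal A = LinearMap.ker (Algebra.linearMap A K) :=
    (IsLocalRing.eq_maximalIdeal (RingHom.ker_isMaximal_of_surjective _ hK)).symm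
  let e : ResidueField A ≃ₗ[A] K :=
    (Submodule.quotEquivOfEq _ _ hker).trans (LinearMap.quotKerEquivOfSurjective _ hK)
  have hsub : Subsingleton (K ⊗[A] (M ⧸ N)) := by
    let g : K ⊗[A] M →ₗ[K] K ⊗[A] (M ⧸ N) := N.mkQ.baseChange K
    have hg : Function.Surjective g := N.mkQ.lTensor_surjective K N.mkQ_surjective
    have hzero : g = 0 := by
      refine LinearMap.ext_on_range hv fun i => ?_
      have : N.mkQ (v i) = 0 := by
        rw [← LinearMap.mem_ker, Submodule.ker_mkQ]
        exact Submodule.subset_span ⟨i, rfl⟩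
      simp only [g, LinearMap.baseChange_tmul, this, tmul_zero, LinearMap.zero_apply]
    refine subsingleton_of_forall_eq 0 fun x => ?_
    obtain ⟨y, rfl⟩ := hg x
    rw [hzero, LinearMap.zero_apply]
  have : Subsingleton (ResidueField A ⊗[A] (M ⧸ N)) :=
    (TensorProduct.congr e (LinearEquiv.refl A (M ⧸ N))).toEquiv.subsingleton
  exact Submodule.Quotient.subsingleton_iff.mp
    (IsLocalRing.subsingleton_tensorProduct.mp this)

/-- A base change `K ⊗ I → K ⊗ Ω` of the differential, where `K` is a field onto which the local
ring `Q` surjects, is injective iff a subfamily of given generators of `I` generates `I` and has an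
invertible maximal Jacobian minor. -/
lemma KaehlerDifferential.injective_iff_exists_isUnit_det {R Q K ι : Type*} {c : ℕ} [CommRing R]
    [CommRing Q] [Field K] [Algebra R Q] [Algebra Q K] [IsLocalRing Q] [Fintype ι]
    (hK : Function.Surjective (algebraMap Q K)) (b : Module.Basis ι Q Ω[Q⁄R]) {I : Ideal Q}
    (f : Fin c → Q) (hf : Ideal.span (Set.range f) = I) (φ : K ⊗[Q] I →ₗ[K] K ⊗[Q] Ω[Q⁄R])
    (hφ : ∀ x : I, φ (1 ⊗ₜ x) = 1 ⊗ₜ D R Q x) :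
    Function.Injective φ ↔
      ∃ (m : ℕ) (ρ : Fin m ↪ Fin c) (τ : Fin m ↪ ι),
        IsUnit (Matrix.det (Matrix.of fun i j => b.repr (D R Q (f (ρ i))) (τ j))) ∧
          Ideal.span (Set.range f) ≤ Ideal.span (Set.range (f ∘ ρ)) := by
  have : Module.Finite Q I := .of_fg (hf ▸ Submodule.fg_span (Set.finite_range f))
  have hloc : IsLocalHom (algebraMap Q K) := .of_surjective _ hK
  have hmem (i : Fin c) : f i ∈ I := hf ▸ Ideal.subset_span ⟨i, rfl⟩
  let v (i : Fin c) : I := ⟨f i, hmem i⟩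
  have hspan_iff {κ : Type} (a : κ → Fin c) :
      Submodule.span Q (Set.range (v ∘ a)) = ⊤ ↔
        Ideal.span (Set.range f) ≤ Ideal.span (Set.range (f ∘ a)) := by
    rw [hf, ← (Submodule.map_injective_of_injective I.injective_subtype).eq_iff,
      Submodule.map_span, ← Set.range_comp, Submodule.map_top, Submodule.range_subtype]
    refine ⟨fun h => h.ge, fun h => le_antisymm ?_ h⟩
    rw [Submodule.span_le]
    rintro _ ⟨i, rfl⟩
    exact hmem _
  let w (i : Fin c) : K ⊗[Q] I := 1 ⊗ₜ v i
  have hspan {κ : Type} (a : κ → Fin c) (h : Submodule.span Q (Set.range (v ∘ a)) = ⊤) :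
      Submodule.span K (Set.range (w ∘ a)) = ⊤ := by
    have := Submodule.baseChange_span (R := Q) (A := K) (Set.range (v ∘ a))
    rw [h, Submodule.baseChange_top, ← Set.range_comp] at this
    exact this.symm
  have hrepr (i : Fin c) (j : ι) :
      (b.baseChange K).repr (φ (w i)) j = algebraMap Q K (b.repr (D R Q (f i)) j) := by
    rw [hφ, Module.Basis.baseChange_repr_tmul, Algebra.smul_def, mul_one]
  have hdet {m : ℕ} (ρ : Fin m → Fin c) (τ : Fin m → ι) :
      IsUnit (Matrix.det (Matrix.of fun i j => b.repr (D R Q (f (ρ i))) (τ j))) ↔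
        IsUnit (Matrix.det
          (Matrix.of fun i j => (b.baseChange K).repr (φ (w (ρ i))) (τ j))) := by
    rw [← isUnit_map_iff (algebraMap Q K), RingHom.map_det]
    simp only [hrepr]
    rfl
  rw [φ.injective_iff_exists_isUnit_det (b.baseChange K) w
    (hspan id ((hspan_iff id).mpr le_rfl))]
  refine exists_congr fun m => exists_congr fun ρ => exists_congr fun τ => ?_
  rw [hdet, ← hspan_iff]
  exact and_congr_right' ⟨IsLocalRing.span_range_eq_top_of_tmul hK (v ∘ ρ), hspan ρ⟩

/-- The **Jacobian criterion** for a local algebra `S = Q / (f)` over `R`, where `Q` is a formally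
smooth local `R`-algebra with a finite basis of Kähler differentials. -/
theorem Algebra.FormallySmooth.iff_exists_isUnit_det {R Q S ι : Type*} {c : ℕ} [CommRing R]
    [CommRing Q] [CommRing S] [Algebra R Q] [Algebra Q S] [Algebra R S] [IsScalarTower R Q S]
    [IsLocalRing Q] [IsLocalRing S] [Algebra.FormallySmooth R Q] [Fintype ι]
    (b : Module.Basis ι Q Ω[Q⁄R]) (hsurj : Function.Surjective (algebraMap Q S))
    (f : Fin c → Q) (hf : Ideal.span (Set.range f) = RingHom.ker (algebraMap Q S)) :
    Algebra.FormallySmooth R S ↔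
      ∃ (m : ℕ) (ρ : Fin m ↪ Fin c) (τ : Fin m ↪ ι),
        IsUnit (Matrix.det (Matrix.of fun i j => b.repr (D R Q (f (ρ i))) (τ j))) ∧
          Ideal.span (Set.range f) ≤ Ideal.span (Set.range (f ∘ ρ)) := by
  have := Module.Free.of_basis b
  have := Module.Finite.of_basis b
  have hfg : (RingHom.ker (algebraMap Q S)).FG := hf ▸ Submodule.fg_span (Set.finite_range f)
  have hK : Function.Surjective (algebraMap Q (IsLocalRing.ResidueField S)) := by
    rw [IsScalarTower.algebraMap_eq Q S]
    exact IsLocalRing.residue_surjective.comp hsurj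
  rw [Algebra.FormallySmooth.iff_injective_cotangentComplexBaseChange_residueField Q hsurj hfg]
  refine KaehlerDifferential.injective_iff_exists_isUnit_det hK b f hf _ fun x => ?_
  rw [cotangentComplexBaseChange_tmul, one_smul, kerToTensor_apply]

/-- Formal smoothness over a localization of the base can be tested over the base. -/
lemma Algebra.FormallySmooth.iff_of_isLocalization {R R' S : Type*} [CommRing R] [CommRing R']
    [CommRing S] [Algebra R R'] [Algebra R' S] [Algebra R S] [IsScalarTower R R' S]
    (M : Submonoid R) [IsLocalization M R'] :
    Algebra.FormallySmooth R' S ↔ Algebra.FormallySmooth R S := by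
  have : Algebra.FormallyEtale R R' := .of_isLocalization M
  exact ⟨fun _ => .comp R R' S, fun _ => .of_restrictScalars R R' S⟩

/-- An inclusion of ideals holds after localizing at a prime iff the colon ideal is not contained
in that prime, if the smaller ideal is finitely generated. -/
lemma IsLocalization.AtPrime.map_le_map_iff_not_colon_le {A : Type*} (B : Type*) [CommRing A]
    [CommRing B] [Algebra A B] (q : Ideal A) [q.IsPrime] [IsLocalization.AtPrime B q]
    {I J : Ideal A} (hI : I.FG) :
    I.map (algebraMap A B) ≤ J.map (algebraMap A B) ↔ ¬ Submodule.colon J (I : Set A) ≤ q := by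
  constructor
  · obtain ⟨s, rfl⟩ := hI
    intro h hle
    have key : ∀ x ∈ s, ∃ t : q.primeCompl, (t : A) * x ∈ J := by
      intro x hx
      have := h (Ideal.mem_map_of_mem _ (Ideal.subset_span hx))
      obtain ⟨t, ht, htx⟩ :=
        (IsLocalization.algebraMap_mem_map_algebraMap_iff q.primeCompl B J x).mp this
      exact ⟨⟨t, ht⟩, htx⟩
    choose! t ht using key
    have hmem : ((∏ x ∈ s, t x : q.primeCompl) : A) ∈
        Submodule.colon J (Ideal.span (s : Set A)) := by
      rw [Ideal.colon_span, Submodule.mem_colon]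
      intro x hx
      have hdvd : t x ∣ ∏ x ∈ s, t x := Finset.dvd_prod_of_mem t hx
      obtain ⟨u, hu⟩ := hdvd
      rw [hu, Submonoid.coe_mul, smul_eq_mul, mul_right_comm]
      exact J.mul_mem_right _ (ht x hx)
    exact (∏ x ∈ s, t x).2 (hle hmem)
  · intro h
    obtain ⟨t, ht, htq⟩ := Set.not_subset.mp h
    rw [Ideal.map_le_iff_le_comap]
    intro x hx
    exact (IsLocalization.algebraMap_mem_map_algebraMap_iff q.primeCompl B J x).mpr
      ⟨t, htq, Submodule.mem_colon.mp ht x hx⟩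

lemma Localization.localRingHom_surjective {A B : Type*} [CommRing A] [CommRing B] {g : A →+* B}
    (hg : Function.Surjective g) (q : Ideal B) [q.IsPrime] :
    Function.Surjective (localRingHom (q.comap g) q g rfl) := by
  have : IsLocalization ((q.comap g).primeCompl.map g) (Localization.AtPrime q) := by
    rw [Ideal.map_primeCompl_comap_of_surjective g hg]
    infer_instance
  exact IsLocalization.map_surjective_of_surjective (q.comap g).primeCompl _ _ hg

lemma Localization.ker_localRingHom {A B : Type*} [CommRing A] [CommRing B] {g : A →+* B}
    (hg : Function.Surjective g) (q : Ideal B) [q.IsPrime] :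
    RingHom.ker (localRingHom (q.comap g) q g rfl) =
      (RingHom.ker g).map (algebraMap A (Localization.AtPrime (q.comap g))) :=
  IsLocalization.ker_map _ g (Ideal.map_primeCompl_comap_of_surjective g hg q)

/-- The differentials of the variables form a basis of the Kähler differentials of a localization of
a polynomial ring. -/
noncomputable def KaehlerDifferential.mvPolynomialLocalizationBasis (R : Type*) {σ Q : Type*}
    [CommRing R] [CommRing Q] [Algebra R Q] [Algebra (MvPolynomial σ R) Q]
    [IsScalarTower R (MvPolynomial σ R) Q] (M : Submonoid (MvPolynomial σ R))
    [IsLocalization M Q] : Module.Basis σ Q Ω[Q⁄R] :=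
  (mvPolynomialBasis R σ).ofIsLocalizedModule Q M (map R R (MvPolynomial σ R) Q)

lemma KaehlerDifferential.mvPolynomialLocalizationBasis_repr_D {R σ Q : Type*}
    [CommRing R] [CommRing Q] [Algebra R Q] [Algebra (MvPolynomial σ R) Q]
    [IsScalarTower R (MvPolynomial σ R) Q] (M : Submonoid (MvPolynomial σ R))
    [IsLocalization M Q] (p : MvPolynomial σ R) (j : σ) :
    (mvPolynomialLocalizationBasis R M).repr (D R Q (algebraMap _ Q p)) j =
      algebraMap _ Q (MvPolynomial.pderiv j p) := by
  rw [← map_D R R, mvPolynomialLocalizationBasis, Module.Basis.ofIsLocalizedModule_repr_apply,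
    mvPolynomialBasis_repr_apply]

/-- The Jacobian criterion for formal smoothness over `R` of the localization at a prime of a
quotient of `R[x_1,…,x_n]`. -/
lemma Algebra.FormallySmooth.localization_atPrime_iff_jacobian {R σ : Type*} [CommRing R]
    [Fintype σ] {c : ℕ} (f : Fin c → MvPolynomial σ R)
    (q : Ideal (MvPolynomial σ R ⧸ Ideal.span (Set.range f))) [q.IsPrime] :
    Algebra.FormallySmooth R (Localization.AtPrime q) ↔
      ∃ (m : ℕ) (ρ : Fin m ↪ Fin c) (τ : Fin m ↪ σ),
        Matrix.det (Matrix.of fun i j => MvPolynomial.pderiv (τ j) (f (ρ i))) ∉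
            q.comap (Ideal.Quotient.mk (Ideal.span (Set.range f))) ∧
          ¬ Submodule.colon (Ideal.span (Set.range fun i => f (ρ i)))
              (Ideal.span (Set.range f)) ≤
            q.comap (Ideal.Quotient.mk (Ideal.span (Set.range f))) := by
  let P := MvPolynomial σ R
  let I : Ideal P := Ideal.span (Set.range f)
  let p : Ideal P := q.comap (Ideal.Quotient.mk I)
  let Q := Localization.AtPrime p
  let : Algebra Q (Localization.AtPrime q) :=
    (Localization.localRingHom p q (Ideal.Quotient.mk I) rfl).toAlgebra
  have : IsScalarTower R Q (Localization.AtPrime q) := .of_algebraMap_eq fun r =>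
    (Localization.localRingHom_to_map p q (Ideal.Quotient.mk I) rfl (algebraMap R P r)).symm
  have hspan {κ : Type} (a : κ → P) : Ideal.span (Set.range (algebraMap P Q ∘ a)) =
      (Ideal.span (Set.range a)).map (algebraMap P Q) := by
    rw [Ideal.map_span, ← Set.range_comp]
  have hker : Ideal.span (Set.range (algebraMap P Q ∘ f)) =
      RingHom.ker (algebraMap Q (Localization.AtPrime q)) := by
    rw [hspan]
    refine .trans ?_ (Localization.ker_localRingHom Ideal.Quotient.mk_surjective q).symm
    rw [Ideal.mk_ker]
  rw [Algebra.FormallySmooth.iff_exists_isUnit_det (mvPolynomialLocalizationBasis R p.primeCompl)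
    (Localization.localRingHom_surjective Ideal.Quotient.mk_surjective q) _ hker]
  refine exists_congr fun m => exists_congr fun ρ => exists_congr fun τ => and_congr ?_ ?_
  · refine Iff.trans ?_ (IsLocalization.AtPrime.isUnit_to_map_iff Q p _)
    rw [RingHom.map_det]
    exact (congrArg (IsUnit <| Matrix.det ·) (Matrix.ext fun i j =>
      mvPolynomialLocalizationBasis_repr_D p.primeCompl (f (ρ i)) (τ j))).to_iff
  · rw [hspan, Function.comp_assoc, hspan]
    exact IsLocalization.AtPrime.map_le_map_iff_not_colon_le Q p
      (Submodule.fg_span (Set.finite_range f))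

end

/-- Let `P = R[x_1,…,x_n]`, `I₁ = (f_1,…,f_c)`, `S̄ = P/I₁`, and let
`𝔭̄` be a prime of `S̄` with preimage `𝔭̃` in `P` and contraction `𝔭'` in `R`.  Then
the induced map `R_{𝔭'} → S̄_{𝔭̄}` is formally smooth iff there are `m ≤ min c n` and
injections `ρ : Fin m ↪ Fin c`, `τ : Fin m ↪ Fin n` such that, with
`I₀ = (f_{ρ 1},…,f_{ρ m})` and `Δ` the determinant of the `m × m` matrix with
`(i,j)`-entry `∂f_{ρ i}/∂x_{τ j}`, one has `Δ ∉ 𝔭̃` and `(I₀ : I₁) ⊄ 𝔭̃`. -/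
theorem formallySmooth_atPrime_iff_jacobian
    {R : Type} [CommRing R] {n c : ℕ} (f : Fin c → MvPolynomial (Fin n) R)
    (𝔭 : Ideal (MvPolynomial (Fin n) R ⧸ Ideal.span (Set.range f))) [𝔭.IsPrime] :
    letI : Algebra
        (Localization.AtPrime (𝔭.comap
          (algebraMap R (MvPolynomial (Fin n) R ⧸ Ideal.span (Set.range f)))))
        (Localization.AtPrime 𝔭) :=
      (Localization.localRingHom
        (𝔭.comap (algebraMap R (MvPolynomial (Fin n) R ⧸ Ideal.span (Set.range f)))) 𝔭
        (algebraMap R (MvPolynomial (Fin n) R ⧸ Ideal.span (Set.range f))) rfl).toAlgebra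
    (Algebra.FormallySmooth
        (Localization.AtPrime (𝔭.comap
          (algebraMap R (MvPolynomial (Fin n) R ⧸ Ideal.span (Set.range f)))))
        (Localization.AtPrime 𝔭) ↔
      ∃ (m : ℕ) (_ : m ≤ min c n) (ρ : Fin m ↪ Fin c) (τ : Fin m ↪ Fin n),
        Matrix.det (Matrix.of fun i j : Fin m => MvPolynomial.pderiv (τ j) (f (ρ i))) ∉
            𝔭.comap (Ideal.Quotient.mk (Ideal.span (Set.range f))) ∧
          ¬ Submodule.colon (Ideal.span (Set.range fun i : Fin m => f (ρ i)))
              (Ideal.span (Set.range f)) ≤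
            𝔭.comap (Ideal.Quotient.mk (Ideal.span (Set.range f)))) := by
  let := (Localization.localRingHom
    (𝔭.comap (algebraMap R (MvPolynomial (Fin n) R ⧸ Ideal.span (Set.range f)))) 𝔭
    (algebraMap R (MvPolynomial (Fin n) R ⧸ Ideal.span (Set.range f))) rfl).toAlgebra
  have : IsScalarTower R (Localization.AtPrime (𝔭.comap
      (algebraMap R (MvPolynomial (Fin n) R ⧸ Ideal.span (Set.range f)))))
      (Localization.AtPrime 𝔭) := .of_algebraMap_eq fun r =>
    (Localization.localRingHom_to_map _ 𝔭
      (algebraMap R (MvPolynomial (Fin n) R ⧸ Ideal.span (Set.range f))) rfl r).symm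
  rw [Algebra.FormallySmooth.iff_of_isLocalization (𝔭.comap (algebraMap R _)).primeCompl,
    Algebra.FormallySmooth.localization_atPrime_iff_jacobian]
  refine exists_congr fun m => ⟨fun ⟨ρ, τ, h⟩ => ⟨?_, ρ, τ, h⟩, fun ⟨_, h⟩ => h⟩
  exact le_min (by simpa using Fintype.card_le_of_embedding ρ)
    (by simpa using Fintype.card_le_of_embedding τ)
end

section
/- Let R be a commutative ring and S an R-algebra that is essentially of finite type over R (i.e., S is a localization of a finite-type R-algebra). Suppose g_1,...,g_l ∈ S generate the unit ideal of S, and that for each i the principal localization S_{g_i} is formally smooth as an R-algebra. Then S is formally smooth as an R-algebra. -/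
/-- Formal smoothness of an algebra essentially of finite type can be checked on a cover of the
target by basic opens. -/
theorem Algebra.FormallySmooth.of_span_eq_top {R S : Type*} [CommRing R] [CommRing S] [Algebra R S]
    [Algebra.EssFiniteType R S] (s : Set S) (hs : Ideal.span s = ⊤)
    (H : ∀ f ∈ s, Algebra.FormallySmooth R (Localization.Away f)) :
    Algebra.FormallySmooth R S := by
  have hproj (f : S) (hf : f ∈ s) :
      Module.Projective (Localization.Away f) (LocalizedModule.Away f Ω[S⁄R]) := by
    have := H f hf
    have e := (IsLocalizedModule.iso (.powers f)
      (KaehlerDifferential.map R R S (Localization.Away f))).extendScalarsOfIsLocalization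
        (.powers f) (Localization.Away f)
    exact .of_equiv e.symm
  have : Module.FinitePresentation S Ω[S⁄R] :=
    Module.FinitePresentation.of_localizationSpan s hs fun f ↦
      have := hproj f f.2
      Module.finitePresentation_of_projective _ _
  refine ⟨?_, ?_⟩
  · rw [← Module.freeLocus_eq_univ_iff, ← Set.univ_subset_iff, ← TopologicalSpace.Opens.coe_top,
      ← PrimeSpectrum.iSup_basicOpen_eq_top_iff'.mpr hs]
    simpa only [TopologicalSpace.Opens.coe_iSup, Set.iUnion_subset_iff,
      Module.basicOpen_subset_freeLocus_iff] using hproj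
  · refine subsingleton_of_forall_eq 0 fun x ↦ ?_
    refine Module.eq_zero_of_isLocalized_span s hs _
      (fun f : s ↦ Algebra.H1Cotangent.map R R S (Localization.Away f.1)) x fun f ↦ ?_
    have := H f f.2
    exact Subsingleton.elim _ _

/-- Let `S` be an `R`-algebra that is essentially of finite type over
`R` (a localization of a finite-type `R`-algebra). If `g_1, …, g_l ∈ S` generate the
unit ideal and each principal localization `S_{g_i}` is formally smooth over `R`,
then `S` is formally smooth over `R`. -/
theorem formallySmooth_of_cover
    {R S : Type} [CommRing R] [CommRing S] [Algebra R S]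
    (heft : ∃ (T : Type) (i1 : CommRing T),
      letI := i1
      ∃ (i2 : Algebra R T),
        letI := i2
        Algebra.FiniteType R T ∧
          ∃ M : Submonoid T, Nonempty (Localization M ≃ₐ[R] S))
    {l : ℕ} (g : Fin l → S) (hg : Ideal.span (Set.range g) = ⊤)
    (hsm : ∀ i, Algebra.FormallySmooth R (Localization.Away (g i))) :
    Algebra.FormallySmooth R S := by
  obtain ⟨T, _, _, hT, M, ⟨e⟩⟩ := heft
  have : Algebra.EssFiniteType R S := (Algebra.EssFiniteType.iff_of_algEquiv e).mp inferInstance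
  exact Algebra.FormallySmooth.of_span_eq_top _ hg (by rintro _ ⟨i, rfl⟩; exact hsm i)
end
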